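/- arXiv:2411.16913 — 2 statements merged into one kernel-verified Lean document; each statement's English description precedes it below -/
import Mathlib

section
/- For all α, β > 0 with α ≠ β, the two-parameter generalized Rényi entropy of the Poisson distribution satisfies lim_{λ→∞} ( H_GR(α,β,λ) - (1/2)·log(2πλ) ) = (log β - log α)/(2(β-α)); in particular H_GR(α,β,λ) → ∞ as λ → ∞. -/
open Real Filter Topology

/-- The Poisson probabilities `p_i(λ) = e^{-λ} λ^i / i!`. -/
noncomputable def poissonP (l : ℝ) (i : ℕ) : ℝ :=
  Real.exp (-l) * l ^ i / (Nat.factorial i)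

/-- `ψ(α,λ) = ∑_{i=0}^∞ (p_i(λ))^α`. -/
noncomputable def psiPoisson (α l : ℝ) : ℝ :=
  ∑' i, (poissonP l i) ^ α

open MeasureTheory

theorem poissonP_pos {l : ℝ} (hl : 0 < l) (i : ℕ) : 0 < poissonP l i := by
  unfold poissonP; positivity

/-- The Poisson probability as a Stirling ratio, times a scale factor, times the exponential of
the large-deviation rate. -/
theorem sqrt_mul_poissonP_eq {l : ℝ} (hl : 0 < l) {i : ℕ} (hi : 0 < i) :
    √l * poissonP l i =
      (√(2 * π * i) * (i / exp 1) ^ i / i.factorial) * (√(l / i) / √(2 * π)) *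
        exp (i - l - i * log (i / l)) := by
  have hi' : (0 : ℝ) < i := by exact_mod_cast hi
  have hpow : exp (i - l - i * log (i / l)) = exp i * exp (-l) * (l / i) ^ i := by
    rw [show (i : ℝ) - l - i * log (i / l) = i + -l + i * log (l / i) by
      rw [log_div hi'.ne' hl.ne', log_div hl.ne' hi'.ne']; ring, exp_add, exp_add,
      exp_nat_mul, exp_log (by positivity)]
  have hexp : exp (1 : ℝ) ^ i = exp i := by rw [← exp_nat_mul, mul_one]
  rw [hpow, sqrt_mul (by positivity), sqrt_div hl.le, div_pow, div_pow, hexp, poissonP]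
  have h1 : √(i : ℝ) ≠ 0 := by positivity
  have h2 : √(2 * π) ≠ 0 := by positivity
  field_simp

theorem sub_sub_mul_log_le {l y : ℝ} (hl : 1 ≤ l) (hy : 0 < y) :
    y - l - y * log (y / l) ≤ 1 - |(y - l) / √l| := by
  have hl0 : 0 < l := by linarith
  have hs : 1 ≤ √l := one_le_sqrt.mpr hl
  have hs2 : √l ^ 2 = l := sq_sqrt hl0.le
  have key : ∀ θ : ℝ, |θ| ≤ 1 → y - l - y * log (y / l) ≤ -(y - l) * θ + l * θ ^ 2 := by
    intro θ hθ
    have h1 := (abs_le.mp (abs_exp_sub_one_sub_id_le hθ)).2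
    have h2 := log_le_sub_one_of_pos (show 0 < l * exp θ / y by positivity)
    rw [log_div (by positivity) hy.ne', log_mul hl0.ne' (exp_ne_zero _), log_exp] at h2
    have h3 : y * (log l + θ - log y) ≤ l * exp θ - y := by
      calc _ ≤ y * (l * exp θ / y - 1) := by gcongr
        _ = _ := by field_simp
    rw [log_div hy.ne' hl0.ne']
    nlinarith
  have hinv : |(√l)⁻¹| ≤ 1 := by
    rw [abs_of_pos (by positivity)]; exact inv_le_one_of_one_le₀ hs
  have hsq : l * (√l)⁻¹ ^ 2 = 1 := by rw [inv_pow, hs2]; field_simp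
  have h1 := key (√l)⁻¹ hinv
  have h2 := key (-(√l)⁻¹) (by rwa [abs_neg])
  rw [neg_sq, hsq] at h2
  rw [hsq] at h1
  rw [div_eq_mul_inv (y - l)]
  rcases abs_cases ((y - l) * (√l)⁻¹) with h | h <;> rw [h.1] <;> linarith

theorem div_le_two_add_sq {l y : ℝ} (hl : 0 < l) (hy : 1 ≤ y) :
    l / y ≤ 2 + 4 * ((y - l) / √l) ^ 2 := by
  rw [div_pow, sq_sqrt hl.le]
  rcases le_total (l / 2) y with h | h
  · have : l / y ≤ 2 := by rw [div_le_iff₀ (by linarith)]; linarith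
    have : 0 ≤ (y - l) ^ 2 / l := by positivity
    linarith
  · have h1 : l / y ≤ l := div_le_self hl.le hy
    have h2 : l / 4 ≤ (y - l) ^ 2 / l := by rw [le_div_iff₀ hl]; nlinarith
    linarith

theorem sqrt_mul_poissonP_le {l : ℝ} (hl : 1 ≤ l) (i : ℕ) :
    √l * poissonP l i ≤ 4 * exp 1 * exp (-|((i : ℝ) - l) / √l| / 2) := by
  have hl0 : 0 < l := by linarith
  have hs : 1 ≤ √l := one_le_sqrt.mpr hl
  have hs2 : √l ^ 2 = l := sq_sqrt hl0.le
  rcases Nat.eq_zero_or_pos i with rfl | hi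
  · have habs : |((0 : ℕ) - l) / √l| = √l := by
      rw [Nat.cast_zero, zero_sub, neg_div, abs_neg, div_sqrt, abs_of_pos (by positivity)]
    rw [habs]
    have h1 : √l ≤ exp (√l - 1) := by linarith [add_one_le_exp (√l - 1)]
    calc √l * poissonP l 0 = √l * exp (-l) := by simp [poissonP]
      _ ≤ exp (√l - 1) * exp (-l) := by gcongr
      _ = exp (√l - 1 - l) := by rw [← exp_add]; rfl
      _ ≤ exp (-√l / 2) := by
        apply exp_le_exp.mpr
        nlinarith
      _ ≤ _ := by
        apply le_mul_of_one_le_left (exp_pos _).le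
        linarith [add_one_le_exp (1 : ℝ)]
  · rw [sqrt_mul_poissonP_eq hl0 hi]
    have hi' : (1 : ℝ) ≤ i := by exact_mod_cast hi
    set x := ((i : ℝ) - l) / √l with hx
    have h1 : √(2 * π * i) * (i / exp 1) ^ i / i.factorial ≤ 1 :=
      div_le_one_of_le₀ (Stirling.le_factorial_stirling i) (by positivity)
    have h2 : √(l / i) / √(2 * π) ≤ 4 * exp (|x| / 2) := by
      have ha : √(l / i) ≤ 2 * (1 + |x|) := by
        apply sqrt_le_iff.mpr ⟨by positivity, (div_le_two_add_sq hl0 hi').trans _⟩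
        nlinarith [abs_nonneg x, sq_abs x]
      have hb : 1 ≤ √(2 * π) := one_le_sqrt.mpr (by linarith [pi_gt_three])
      have hc := add_one_le_exp (|x| / 2)
      calc _ ≤ √(l / i) := div_le_self (by positivity) hb
        _ ≤ _ := by nlinarith [abs_nonneg x]
    calc _ ≤ 1 * (4 * exp (|x| / 2)) * exp (1 - |x|) := by
          gcongr ?_ * ?_ * exp ?_
          exact sub_sub_mul_log_le hl (zero_lt_one.trans_le hi')
      _ = 4 * exp 1 * exp (-|x| / 2) := by
        rw [one_mul, mul_assoc, mul_assoc, ← exp_add, ← exp_add]; ring_nf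

theorem tendsto_add_mul_sqrt_atTop (x : ℝ) :
    Tendsto (fun l : ℝ => l + x * √l) atTop atTop := by
  have h : Tendsto (fun l : ℝ => √l * (√l + x)) atTop atTop :=
    tendsto_sqrt_atTop.atTop_mul_atTop₀ (tendsto_atTop_add_const_right _ _ tendsto_sqrt_atTop)
  refine h.congr' ?_
  filter_upwards [eventually_ge_atTop 0] with l hl
  rw [mul_add, mul_self_sqrt hl, mul_comm x]

theorem tendsto_floor_sub_div_sqrt (x : ℝ) :
    Tendsto (fun l : ℝ => ((⌊l + x * √l⌋₊ : ℝ) - l) / √l) atTop (𝓝 x) := by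
  have hlow : Tendsto (fun l : ℝ => x - (√l)⁻¹) atTop (𝓝 x) := by
    simpa using tendsto_const_nhds.sub tendsto_sqrt_atTop.inv_tendsto_atTop
  refine tendsto_of_tendsto_of_tendsto_of_le_of_le' hlow tendsto_const_nhds ?_ ?_
  · filter_upwards [eventually_gt_atTop 0] with l hl
    have hs : 0 < √l := sqrt_pos.mpr hl
    rw [le_div_iff₀ hs, sub_mul, inv_mul_cancel₀ hs.ne']
    linarith [Nat.lt_floor_add_one (l + x * √l)]
  · filter_upwards [eventually_gt_atTop 0,
      (tendsto_add_mul_sqrt_atTop x).eventually_ge_atTop 0] with l hl h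
    rw [div_le_iff₀ (sqrt_pos.mpr hl)]
    linarith [Nat.floor_le h]

theorem abs_log_one_add_sub_le {t : ℝ} (ht : |t| ≤ 1 / 2) :
    |log (1 + t) - (t - t ^ 2 / 2)| ≤ 2 * |t| ^ 3 := by
  have h := abs_log_sub_add_sum_range_le (x := -t) (by rw [abs_neg]; linarith) 2
  simp only [Finset.sum_range_succ, Finset.sum_range_zero, abs_neg, sub_neg_eq_add] at h
  norm_num at h
  calc _ = |-t + t ^ 2 / 2 + log (1 + t)| := by congr 1; ring
    _ ≤ |t| ^ 3 / (1 - |t|) := h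
    _ ≤ _ := by
      rw [div_le_iff₀ (by linarith)]
      nlinarith [pow_nonneg (abs_nonneg t) 3]

/-- Quadratic approximation of the Poisson rate function at the scale `√l`. -/
theorem tendsto_sub_sub_mul_log {y : ℝ → ℝ} {x : ℝ}
    (hy : Tendsto (fun l => (y l - l) / √l) atTop (𝓝 x)) :
    Tendsto (fun l => y l - l - y l * log (y l / l)) atTop (𝓝 (-x ^ 2 / 2)) := by
  set z := fun l => (y l - l) / √l with hz
  have hinv : Tendsto (fun l : ℝ => (√l)⁻¹) atTop (𝓝 0) := tendsto_sqrt_atTop.inv_tendsto_atTop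
  have ht : Tendsto (fun l => z l * (√l)⁻¹) atTop (𝓝 0) := by simpa using hy.mul hinv
  have hsmall : ∀ᶠ l in atTop, |z l * (√l)⁻¹| ≤ 1 / 2 := by
    have := ht.abs
    rw [abs_zero] at this
    exact this.eventually_le_const (by norm_num)
  have herr : Tendsto (fun l => l * (log (1 + z l * (√l)⁻¹) -
      (z l * (√l)⁻¹ - (z l * (√l)⁻¹) ^ 2 / 2))) atTop (𝓝 0) := by
    have hb : Tendsto (fun l => 2 * (|z l| ^ 3 * (√l)⁻¹)) atTop (𝓝 0) := by
      simpa using ((hy.abs.pow 3).mul hinv).const_mul 2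
    refine squeeze_zero_norm' ?_ hb
    filter_upwards [hsmall, eventually_gt_atTop 0] with l h hl
    have hs : 0 < √l := sqrt_pos.mpr hl
    rw [norm_mul, norm_eq_abs, norm_eq_abs, abs_of_pos hl]
    calc _ ≤ l * (2 * |z l * (√l)⁻¹| ^ 3) := by gcongr; exact abs_log_one_add_sub_le h
      _ = √l ^ 2 * (2 * |z l * (√l)⁻¹| ^ 3) := by rw [sq_sqrt hl.le]
      _ = _ := by
        rw [abs_mul, abs_of_pos (inv_pos.mpr hs)]; field_simp
  have hlim : Tendsto (fun l => -(z l) ^ 2 / 2 + z l ^ 2 * (z l * (√l)⁻¹) / 2 -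
      (1 + z l * (√l)⁻¹) * (l * (log (1 + z l * (√l)⁻¹) -
      (z l * (√l)⁻¹ - (z l * (√l)⁻¹) ^ 2 / 2)))) atTop (𝓝 (-x ^ 2 / 2)) := by
    have := ((((hy.pow 2).neg).div_const 2).add (((hy.pow 2).mul ht).div_const 2)).sub
      ((ht.const_add 1).mul herr)
    simpa using this
  refine hlim.congr' ?_
  filter_upwards [eventually_gt_atTop 0] with l hl
  have hs : 0 < √l := sqrt_pos.mpr hl
  have hs2 : √l ^ 2 = l := sq_sqrt hl.le
  have hzt : z l * (√l)⁻¹ = (y l - l) / l := by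
    rw [hz]; simp only; rw [← div_eq_mul_inv, div_div, mul_self_sqrt hl.le]
  have hz2 : z l ^ 2 = (y l - l) ^ 2 / l := by rw [hz]; simp only; rw [div_pow, hs2]
  have h1 : 1 + (y l - l) / l = y l / l := by field_simp; ring
  rw [hzt, hz2, h1]
  field_simp
  ring

/-- Local central limit theorem for the Poisson distribution. -/
theorem tendsto_sqrt_mul_poissonP (x : ℝ) :
    Tendsto (fun l : ℝ => √l * poissonP l ⌊l + x * √l⌋₊) atTop
      (𝓝 (exp (-x ^ 2 / 2) / √(2 * π))) := by
  have hfl : Tendsto (fun l : ℝ => ⌊l + x * √l⌋₊) atTop atTop :=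
    tendsto_nat_floor_atTop.comp (tendsto_add_mul_sqrt_atTop x)
  have hz := tendsto_floor_sub_div_sqrt x
  have hst : Tendsto (fun i : ℕ => √(2 * π * i) * (i / exp 1) ^ i / i.factorial)
      atTop (𝓝 1) := by
    have h := (Asymptotics.isEquivalent_iff_tendsto_one
      (Eventually.of_forall fun i => by positivity)).mp Stirling.factorial_isEquivalent_stirling.symm
    refine h.congr fun i => ?_
    simp only [Pi.div_apply]
    rw [mul_right_comm 2 (i : ℝ) π]
  have hratio : Tendsto (fun l : ℝ => l / (⌊l + x * √l⌋₊ : ℝ)) atTop (𝓝 1) := by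
    have h := ((hz.mul tendsto_sqrt_atTop.inv_tendsto_atTop).const_add 1).inv₀ (by simp)
    simp only [mul_zero, add_zero, inv_one] at h
    refine h.congr' ?_
    filter_upwards [eventually_gt_atTop 0] with l hl
    simp only [Pi.inv_apply]
    rw [← div_eq_mul_inv, div_div, mul_self_sqrt hl.le, one_add_div hl.ne', inv_div,
      add_sub_cancel]
  have h := ((hst.comp hfl).mul ((hratio.sqrt).div_const √(2 * π))).mul
    (tendsto_sub_sub_mul_log hz).rexp
  rw [sqrt_one, one_mul, one_div_mul_eq_div] at h
  refine h.congr' ?_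
  filter_upwards [eventually_gt_atTop 0, hfl.eventually_gt_atTop 0] with l hl hi
  exact (sqrt_mul_poissonP_eq hl hi).symm

/-- The rescaled `α`-th powers of the Poisson probabilities, as a step function on the line. -/
noncomputable def poissonStep (α l : ℝ) : ℝ → ℝ :=
  Set.indicator {x | 0 ≤ l + x * √l} fun x => (√l * poissonP l ⌊l + x * √l⌋₊) ^ α

theorem measurable_poissonStep (α l : ℝ) : Measurable (poissonStep α l) := by
  refine Measurable.indicator ?_ (measurableSet_le measurable_const (by fun_prop))
  have h : Measurable fun x : ℝ => ⌊l + x * √l⌋₊ := Nat.measurable_floor.comp (by fun_prop)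
  exact (measurable_from_top (f := fun i : ℕ => (√l * poissonP l i) ^ α)).comp h

theorem poissonStep_nonneg (α : ℝ) {l : ℝ} (hl : 0 < l) (x : ℝ) : 0 ≤ poissonStep α l x :=
  Set.indicator_nonneg
    (fun _ _ => rpow_nonneg (mul_nonneg (sqrt_nonneg l) (poissonP_pos hl _).le) α) x

theorem poissonStep_le {α l : ℝ} (hα : 0 < α) (hl : 1 ≤ l) (x : ℝ) :
    poissonStep α l x ≤ (4 * exp 1 * exp (1 / 2)) ^ α * exp (-(α / 2) * |x|) := by
  have hl0 : 0 < l := by linarith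
  have hs : 1 ≤ √l := one_le_sqrt.mpr hl
  have hs0 : 0 < √l := by linarith
  rw [poissonStep]
  refine Set.indicator_apply_le' (fun hx => ?_) (fun _ => by positivity)
  rw [Set.mem_ofPred_eq] at hx
  set i := ⌊l + x * √l⌋₊
  have hdist : |x| - 1 ≤ |((i : ℝ) - l) / √l| := by
    have h1 : |x - ((i : ℝ) - l) / √l| ≤ 1 := by
      have h2 : x - ((i : ℝ) - l) / √l = (l + x * √l - i) / √l := by field_simp; ring
      rw [h2, abs_div, abs_of_pos hs0]
      refine div_le_one_of_le₀ (le_trans ?_ hs) hs0.le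
      rw [abs_le]
      constructor <;> linarith [Nat.floor_le hx, Nat.lt_floor_add_one (l + x * √l)]
    linarith [abs_sub_abs_le_abs_sub x (((i : ℝ) - l) / √l)]
  have hp := poissonP_pos hl0 i
  calc (√l * poissonP l i) ^ α ≤ (4 * exp 1 * exp (1 / 2) * exp (-|x| / 2)) ^ α := by
        refine rpow_le_rpow (by positivity) ((sqrt_mul_poissonP_le hl i).trans ?_) hα.le
        rw [mul_assoc (4 * exp 1), ← exp_add]
        gcongr
        linarith
    _ = _ := by
        rw [mul_rpow (by positivity) (by positivity), ← exp_mul]; ring_nf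

theorem integrable_exp_neg_mul_abs {b : ℝ} (hb : 0 < b) :
    Integrable fun x : ℝ => exp (-b * |x|) := by
  rw [← integrableOn_univ, ← Set.Iic_union_Ioi (a := (0 : ℝ))]
  refine IntegrableOn.union ?_ ?_
  · refine (integrableOn_exp_mul_Iic hb 0).congr_fun (fun x hx => ?_) measurableSet_Iic
    simp only [abs_of_nonpos (Set.mem_Iic.mp hx), neg_mul_neg]
  · refine (integrableOn_exp_mul_Ioi (neg_neg_of_pos hb) 0).congr_fun (fun x hx => ?_)
      measurableSet_Ioi
    simp only [abs_of_pos (Set.mem_Ioi.mp hx)]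

theorem integrable_poissonStep {α l : ℝ} (hα : 0 < α) (hl : 1 ≤ l) :
    Integrable (poissonStep α l) := by
  refine ((integrable_exp_neg_mul_abs (half_pos hα)).const_mul
    ((4 * exp 1 * exp (1 / 2)) ^ α)).mono' (measurable_poissonStep α l).aestronglyMeasurable
    (ae_of_all _ fun x => ?_)
  rw [norm_of_nonneg (poissonStep_nonneg α (by linarith) x)]
  exact poissonStep_le hα hl x

theorem integral_poissonStep {α l : ℝ} (hα : 0 < α) (hl : 1 ≤ l) :
    ∫ x, poissonStep α l x = l ^ ((α - 1) / 2) * psiPoisson α l := by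
  have hl0 : 0 < l := by linarith
  have hs0 : 0 < √l := sqrt_pos.mpr hl0
  set S : ℕ → Set ℝ := fun i => Set.Ico (((i : ℝ) - l) / √l) (((i : ℝ) + 1 - l) / √l) with hS
  have hmem : ∀ i x, x ∈ S i ↔ 0 ≤ l + x * √l ∧ ⌊l + x * √l⌋₊ = i := by
    intro i x
    simp only [hS, Set.mem_Ico, div_le_iff₀ hs0, lt_div_iff₀ hs0]
    constructor
    · rintro ⟨h1, h2⟩
      have h0 : 0 ≤ l + x * √l := by linarith [(Nat.cast_nonneg i : (0 : ℝ) ≤ i)]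
      exact ⟨h0, (Nat.floor_eq_iff h0).mpr ⟨by linarith, by linarith⟩⟩
    · rintro ⟨h0, h⟩
      have := (Nat.floor_eq_iff h0).mp h
      exact ⟨by linarith, by linarith⟩
  have hUnion : ⋃ i, S i = {x | 0 ≤ l + x * √l} := by
    ext x
    simp only [Set.mem_iUnion, hmem, Set.mem_ofPred_eq]
    simp
  have hdisj : Pairwise (Function.onFun Disjoint S) := by
    intro i j hij
    refine Set.disjoint_left.mpr fun x hi hj => hij ?_
    rw [← ((hmem i x).mp hi).2, ← ((hmem j x).mp hj).2]
  have hsum := hasSum_integral_iUnion (μ := volume) (fun i => measurableSet_Ico) hdisj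
    (integrable_poissonStep hα hl).integrableOn
  have hterm : ∀ i, ∫ x in S i, poissonStep α l x = l ^ ((α - 1) / 2) * poissonP l i ^ α := by
    intro i
    have hconst : Set.EqOn (poissonStep α l) (fun _ => (√l * poissonP l i) ^ α) (S i) := by
      intro x hx
      obtain ⟨h0, h⟩ := (hmem i x).mp hx
      rw [poissonStep, Set.indicator_of_mem (by exact h0), h]
    rw [setIntegral_congr_fun measurableSet_Ico hconst, setIntegral_const,
      Real.volume_real_Ico_of_le (by gcongr; linarith), smul_eq_mul,
      mul_rpow hs0.le (poissonP_pos hl0 i).le, ← mul_assoc, ← sub_div]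
    congr 1
    rw [show (i : ℝ) + 1 - l - (i - l) = 1 by ring, sqrt_eq_rpow, ← rpow_mul hl0.le, one_div,
      ← rpow_neg hl0.le, ← rpow_add hl0]
    ring_nf
  have hset : ∫ x in ⋃ i, S i, poissonStep α l x = ∫ x, poissonStep α l x := by
    refine setIntegral_eq_integral_of_forall_compl_eq_zero fun x hx => ?_
    rw [hUnion] at hx
    exact Set.indicator_of_notMem hx _
  rw [← hset, ← hsum.tsum_eq, psiPoisson, ← tsum_mul_left]
  exact tsum_congr hterm

theorem integral_gaussian_density_rpow {α : ℝ} :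
    ∫ x : ℝ, (exp (-x ^ 2 / 2) / √(2 * π)) ^ α = (√(2 * π) ^ α)⁻¹ * √(2 * π / α) := by
  have h : ∀ x : ℝ, (exp (-x ^ 2 / 2) / √(2 * π)) ^ α =
      (√(2 * π) ^ α)⁻¹ * exp (-(α / 2) * x ^ 2) := by
    intro x
    rw [div_rpow (exp_pos _).le (sqrt_nonneg _), ← exp_mul, div_eq_inv_mul]
    ring_nf
  simp_rw [h]
  rw [integral_const_mul, integral_gaussian, div_div_eq_mul_div, mul_comm π]

theorem tendsto_integral_poissonStep {α : ℝ} (hα : 0 < α) :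
    Tendsto (fun l => ∫ x, poissonStep α l x) atTop (𝓝 ((√(2 * π) ^ α)⁻¹ * √(2 * π / α))) := by
  rw [← integral_gaussian_density_rpow]
  refine tendsto_integral_filter_of_dominated_convergence
    (fun x => (4 * exp 1 * exp (1 / 2)) ^ α * exp (-(α / 2) * |x|))
    (Eventually.of_forall fun l => (measurable_poissonStep α l).aestronglyMeasurable) ?_
    ((integrable_exp_neg_mul_abs (half_pos hα)).const_mul _) (ae_of_all _ fun x => ?_)
  · filter_upwards [eventually_ge_atTop 1] with l hl
    refine ae_of_all _ fun x => ?_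
    rw [norm_of_nonneg (poissonStep_nonneg α (by linarith) x)]
    exact poissonStep_le hα hl x
  · refine ((tendsto_sqrt_mul_poissonP x).rpow_const (Or.inr hα.le)).congr' ?_
    filter_upwards [(tendsto_add_mul_sqrt_atTop x).eventually_ge_atTop 0] with l hl
    rw [poissonStep, Set.indicator_of_mem (by exact hl)]

theorem eventually_psiPoisson_ne_zero {α : ℝ} (hα : 0 < α) :
    ∀ᶠ l in atTop, psiPoisson α l ≠ 0 := by
  filter_upwards [eventually_ge_atTop 1,
    (tendsto_integral_poissonStep hα).eventually_ne (by positivity)] with l hl h h0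
  rw [integral_poissonStep hα hl, h0, mul_zero] at h
  exact h rfl

theorem tendsto_log_psiPoisson {α : ℝ} (hα : 0 < α) :
    Tendsto (fun l => log (psiPoisson α l) + (α - 1) / 2 * log (2 * π * l)) atTop
      (𝓝 (-log α / 2)) := by
  have hlim : (0 : ℝ) < (√(2 * π) ^ α)⁻¹ * √(2 * π / α) := by positivity
  have h := ((tendsto_integral_poissonStep hα).log hlim.ne').add_const
    ((α - 1) / 2 * log (2 * π))
  have hval : log ((√(2 * π) ^ α)⁻¹ * √(2 * π / α)) + (α - 1) / 2 * log (2 * π) =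
      -log α / 2 := by
    rw [log_mul (by positivity) (by positivity), log_inv, log_rpow (by positivity),
      log_sqrt (by positivity), log_sqrt (by positivity), log_div (by positivity) hα.ne']
    ring
  rw [hval] at h
  refine h.congr' ?_
  filter_upwards [eventually_ge_atTop 1, eventually_psiPoisson_ne_zero hα] with l hl h0
  have hl0 : 0 < l := by linarith
  rw [integral_poissonStep hα hl, log_mul (by positivity) h0, log_rpow hl0,
    log_mul (by positivity) hl0.ne']
  ring

/-- asymptotics of the two-parameter generalized Rényi entropy of
the Poisson distribution. -/
theorem genRenyi2_poisson_asymptotic (α β : ℝ) (hα : 0 < α) (hβ : 0 < β) (hαβ : α ≠ β) :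
    Tendsto (fun l : ℝ => (β - α)⁻¹ * Real.log (psiPoisson α l / psiPoisson β l)
        - (1 / 2) * Real.log (2 * Real.pi * l))
      atTop (𝓝 ((Real.log β - Real.log α) / (2 * (β - α)))) ∧
    Tendsto (fun l : ℝ => (β - α)⁻¹ * Real.log (psiPoisson α l / psiPoisson β l))
      atTop atTop := by
  have hne : β - α ≠ 0 := sub_ne_zero.mpr hαβ.symm
  have hmain : Tendsto (fun l : ℝ => (β - α)⁻¹ * Real.log (psiPoisson α l / psiPoisson β l)
        - (1 / 2) * Real.log (2 * Real.pi * l))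
      atTop (𝓝 ((Real.log β - Real.log α) / (2 * (β - α)))) := by
    have h := ((tendsto_log_psiPoisson hα).sub (tendsto_log_psiPoisson hβ)).const_mul (β - α)⁻¹
    rw [show (β - α)⁻¹ * (-log α / 2 - -log β / 2) = (log β - log α) / (2 * (β - α)) by
      field_simp; ring] at h
    refine h.congr' ?_
    filter_upwards [eventually_psiPoisson_ne_zero hα, eventually_psiPoisson_ne_zero hβ]
      with l h1 h2
    rw [log_div h1 h2]
    field_simp
    ring
  have hlog : Tendsto (fun l : ℝ => 1 / 2 * log (2 * π * l)) atTop atTop :=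
    (tendsto_log_atTop.comp (tendsto_id.const_mul_atTop (by positivity))).const_mul_atTop
      (by norm_num)
  exact ⟨hmain, (hmain.add_atTop hlog).congr fun l => sub_add_cancel _ _⟩
end

section
/- For every λ > 1, the Shannon entropy of the Poisson distribution satisfies H_SH(λ) ≤ (1/2)·log(2πλ) + 1 + 1/(6λ). -/
open Real Filter Topology

/-- Upper Stirling bound with Robbins' error term, stated for the Stirling sequence. -/
theorem log_stirlingSeq_le {n : ℕ} (hn : n ≠ 0) :
    log (Stirling.stirlingSeq n) ≤ log π / 2 + 1 / (12 * n) := by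
  have hmono : Monotone fun k : ℕ =>
      log (Stirling.stirlingSeq (k + 1)) - 1 / (12 * ((k + 1 : ℕ) : ℝ)) := by
    refine monotone_nat_of_le_succ fun k => ?_
    have h := Stirling.log_stirlingSeq_sdiff_le (k + 1)
    have e : 1 / (12 * ((k + 1 : ℕ) : ℝ) * (((k + 1 : ℕ) : ℝ) + 1)) =
        1 / (12 * ((k + 1 : ℕ) : ℝ)) - 1 / (12 * ((k + 1 + 1 : ℕ) : ℝ)) := by
      push_cast
      field
    linarith
  have hlog : Tendsto (fun k : ℕ => log (Stirling.stirlingSeq k)) atTop (𝓝 (log √π)) :=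
    Stirling.tendsto_stirlingSeq_sqrt_pi.log (by positivity)
  have herr : Tendsto (fun k : ℕ => 1 / (12 * (k : ℝ))) atTop (𝓝 0) := by
    simpa [div_eq_mul_inv, mul_comm] using
      (tendsto_inv_atTop_nhds_zero_nat (𝕜 := ℝ)).mul_const 12⁻¹
  have hlim := (tendsto_add_atTop_iff_nat 1).2 (hlog.sub herr)
  obtain ⟨m, rfl⟩ := Nat.exists_eq_succ_of_ne_zero hn
  have h := hmono.ge_of_tendsto hlim m
  rw [log_sqrt pi_pos.le] at h
  simp only [Nat.succ_eq_add_one] at *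
  linarith

theorem log_factorial_le {n : ℕ} (hn : n ≠ 0) :
    log n.factorial ≤
      (n + 1 / 2) * log n - n + log (2 * π) / 2 + 1 / (12 * n) := by
  have hn' : (0 : ℝ) < n := by positivity
  have h := log_stirlingSeq_le hn
  rw [Stirling.log_stirlingSeq_formula, log_mul two_ne_zero hn'.ne',
    log_div hn'.ne' (exp_ne_zero 1), log_exp] at h
  rw [log_mul two_ne_zero pi_ne_zero]
  linarith

theorem poissonP_nonneg {l : ℝ} (hl : 0 ≤ l) (i : ℕ) : 0 ≤ poissonP l i := by
  unfold poissonP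
  positivity

theorem hasSum_poissonP (l : ℝ) : HasSum (poissonP l) 1 := by
  have h := (NormedSpace.expSeries_div_hasSum_exp l).mul_left (exp (-l))
  rw [← exp_eq_exp_ℝ, ← exp_add, neg_add_cancel, exp_zero] at h
  simp only [← mul_div_assoc] at h
  exact h

theorem poissonP_succ_mul (l : ℝ) (i : ℕ) :
    ((i : ℝ) + 1) * poissonP l (i + 1) = l * poissonP l i := by
  unfold poissonP
  rw [Nat.factorial_succ]
  push_cast
  field

theorem hasSum_mul_poissonP (l : ℝ) : HasSum (fun i : ℕ => i * poissonP l i) l := by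
  rw [← hasSum_nat_add_iff' 1]
  simpa [poissonP_succ_mul] using (hasSum_poissonP l).mul_left l

theorem hasSum_mul_sub_one_mul_poissonP (l : ℝ) :
    HasSum (fun i : ℕ => i * (i - 1) * poissonP l i) (l ^ 2) := by
  rw [← hasSum_nat_add_iff' 1]
  have h := (hasSum_mul_poissonP l).mul_left l
  convert! h using 1
  · funext i
    push_cast
    linear_combination (i : ℝ) * poissonP_succ_mul l i
  · simp [sq]

theorem hasSum_poissonP_div_succ {l : ℝ} (hl : l ≠ 0) :
    HasSum (fun i : ℕ => poissonP l i / (i + 1)) ((1 - exp (-l)) / l) := by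
  have h := ((hasSum_nat_add_iff' 1).2 (hasSum_poissonP l)).div_const l
  convert! h using 1
  · funext i
    rw [div_eq_div_iff (by positivity) hl]
    linarith [poissonP_succ_mul l i]
  · simp [poissonP]

theorem log_poissonP {l : ℝ} (hl : 0 < l) (i : ℕ) :
    log (poissonP l i) = -l + i * log l - log i.factorial := by
  unfold poissonP
  rw [log_div (by positivity) (by positivity), log_mul (by positivity) (by positivity),
    log_exp, log_pow]

/-- A pointwise bound on the information content of the Poisson distribution, whose terms all have
explicit Poisson expectations. -/
theorem neg_log_poissonP_le {l : ℝ} (hl : 1 ≤ l) (i : ℕ) :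
    -log (poissonP l i) ≤
      i * (i - 1) / l + i * (3 / (2 * l) - 2) +
        (l - 1 / 2 + log (2 * π * l) / 2) + 1 / 6 / (i + 1) := by
  have hl0 : 0 < l := by linarith
  rw [log_poissonP hl0]
  rcases eq_or_ne i 0 with rfl | hi
  · have h : 1 ≤ log (2 * π * l) := by
      rw [le_log_iff_exp_le (by positivity)]
      nlinarith [exp_one_lt_d9, pi_gt_three]
    norm_num
    linarith
  · have hi' : (1 : ℝ) ≤ i := by exact_mod_cast Nat.one_le_iff_ne_zero.2 hi
    have hfac := log_factorial_le hi
    have hlog := log_le_sub_one_of_pos (show 0 < (i : ℝ) / l by positivity)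
    rw [log_div (by positivity) hl0.ne'] at hlog
    have hmul := mul_le_mul_of_nonneg_left hlog (show (0 : ℝ) ≤ i + 1 / 2 by positivity)
    have herr : 1 / (12 * (i : ℝ)) ≤ 1 / 6 / (i + 1) := by
      rw [div_div]
      exact one_div_le_one_div_of_le (by positivity) (by linarith)
    have e : ((i : ℝ) + 1 / 2) * (i / l - 1) =
        i * (i - 1) / l + i * (3 / (2 * l) - 1) - 1 / 2 := by
      field
    rw [log_mul (by positivity) hl0.ne']
    linarith

/-- upper bound for the Shannon entropy of the Poisson
distribution, for λ > 1. -/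
theorem shannon_poisson_upper_bound (l : ℝ) (hl : 1 < l) :
    (-∑' i, poissonP l i * Real.log (poissonP l i)) ≤
      (1 / 2) * Real.log (2 * Real.pi * l) + 1 + 1 / (6 * l) := by
  have hl0 : 0 < l := by linarith
  by_cases hs : Summable fun i => poissonP l i * log (poissonP l i)
  · have hB := ((((hasSum_mul_sub_one_mul_poissonP l).div_const l).add
      ((hasSum_mul_poissonP l).mul_left (3 / (2 * l) - 2))).add
      ((hasSum_poissonP l).mul_left (l - 1 / 2 + log (2 * π * l) / 2))).add
      ((hasSum_poissonP_div_succ hl0.ne').mul_left (1 / 6))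
    have h := hasSum_le (fun i => ?_) hs.hasSum.neg hB
    · refine h.trans ?_
      have e : l ^ 2 / l + (3 / (2 * l) - 2) * l + (l - 1 / 2 + log (2 * π * l) / 2) * 1 +
          1 / 6 * ((1 - exp (-l)) / l) =
          1 / 2 * log (2 * π * l) + 1 + 1 / (6 * l) - exp (-l) / (6 * l) := by
        field
      have hexp : 0 ≤ exp (-l) / (6 * l) := by positivity
      linarith
    · have hi := mul_le_mul_of_nonneg_left (neg_log_poissonP_le hl.le i)
        (poissonP_nonneg hl0.le i)
      calc
        _ = poissonP l i * -log (poissonP l i) := by ring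
        _ ≤ _ := hi
        _ = _ := by ring
  · rw [tsum_eq_zero_of_not_summable hs, neg_zero]
    have hlog : 0 ≤ log (2 * π * l) := log_nonneg (by nlinarith [pi_gt_three])
    positivity
end
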